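/- Let μ be a doubling Borel measure on ℝ^n and fix 1 ≤ p < q < ∞. Then there is a constant C = C(μ,p,q,n) such that for every finite collection 𝒥 of cubes and every set {f_Q : Q ∈ 𝒥} of nonnegative μ-integrable functions with supp(f_Q) ⊂ Q, one has ‖Σ_{Q∈𝒥} f_Q‖_{L^p(μ)} ≤ C ‖Σ_{Q∈𝒥} a_q^μ(Q) χ_Q‖_{L^p(μ)}, where a_q^μ(Q) = (μ(Q)^{−1} ∫_Q |f_Q|^q dμ)^{1/q}. -/

import Mathlib

open MeasureTheory Set
open scoped ENNReal BigOperators NNReal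

noncomputable section

namespace Paper

/-! ### Iterated partial derivatives and multi-indices -/

/-- Partial derivative in the `i`-th coordinate direction. -/
def pd {ι : Type*} [Fintype ι] [DecidableEq ι] (i : ι) (f : (ι → ℝ) → ℝ) :
    (ι → ℝ) → ℝ :=
  fun x => fderiv ℝ f x (Pi.single i 1)

/-- Iterated partial derivatives along a list of coordinate directions. -/
def pdList {ι : Type*} [Fintype ι] [DecidableEq ι] :
    List ι → ((ι → ℝ) → ℝ) → (ι → ℝ) → ℝ
  | [], f => f
  | i :: l, f => pdList l (pd i f)

/-- `∂^α f` for a multi-index `α`. -/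
def pdMulti {ι : Type*} [Fintype ι] [DecidableEq ι] (α : ι → ℕ)
    (f : (ι → ℝ) → ℝ) : (ι → ℝ) → ℝ :=
  pdList (Finset.univ.toList.flatMap fun i => List.replicate (α i) i) f

/-- All multi-indices on `Fin n` of total degree at most `N`. -/
def multiIndices (n N : ℕ) : Finset (Fin n → ℕ) :=
  ((Finset.univ : Finset (Fin n → Fin (N + 1))).image fun g i => (g i : ℕ)).filter
    fun α => ∑ i, α i ≤ N

/-! ### Cubes -/

/-- An axis-parallel cube in `ℝⁿ`, given by its center and (positive) side length. -/
structure Cube (n : ℕ) where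
  c : Fin n → ℝ
  h : ℝ
  h_pos : 0 < h

/-- The (closed) cube as a subset of `ℝⁿ`. -/
def Cube.set {n : ℕ} (Q : Cube n) : Set (Fin n → ℝ) :=
  {x | ∀ i, |x i - Q.c i| ≤ Q.h / 2}

/-- The set `τ Q`: the concentric dilate of `Q` by factor `τ`. -/
def Cube.scaleSet {n : ℕ} (τ : ℝ) (Q : Cube n) : Set (Fin n → ℝ) :=
  {x | ∀ i, |x i - Q.c i| ≤ τ * Q.h / 2}

/-- The cube `τ Q` for `τ > 0`. -/
def Cube.scale {n : ℕ} (Q : Cube n) (τ : ℝ) (hτ : 0 < τ) : Cube n :=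
  ⟨Q.c, τ * Q.h, mul_pos hτ Q.h_pos⟩

/-- Characteristic function of a set. -/
def chi {n : ℕ} (s : Set (Fin n → ℝ)) : (Fin n → ℝ) → ℝ :=
  s.indicator fun _ => 1

/-- Average of `w` over a set (w.r.t. Lebesgue measure). -/
def avgOn {n : ℕ} (s : Set (Fin n → ℝ)) (w : (Fin n → ℝ) → ℝ) : ℝ :=
  (∫ x in s, w x) / (volume s).toReal

/-! ### Muckenhoupt weights -/

/-- A weight: nonnegative (indeed a.e. positive) locally integrable function. -/
def IsWeight {n : ℕ} (w : (Fin n → ℝ) → ℝ) : Prop :=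
  LocallyIntegrable w volume ∧ ∀ᵐ x ∂volume, 0 < w x

/-- The Muckenhoupt class `A_1`. -/
def IsA1 {n : ℕ} (w : (Fin n → ℝ) → ℝ) : Prop :=
  IsWeight w ∧ ∃ C : ℝ, ∀ Q : Cube n, ∀ᵐ x ∂volume, x ∈ Q.set → avgOn Q.set w ≤ C * w x

/-- The `A_1` characteristic `[w]_{A_1}` (the least admissible constant). -/
def A1Const {n : ℕ} (w : (Fin n → ℝ) → ℝ) : ℝ :=
  sInf {C : ℝ | ∀ Q : Cube n, ∀ᵐ x ∂volume, x ∈ Q.set → avgOn Q.set w ≤ C * w x}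

/-- The Muckenhoupt class `A_q` for `1 < q < ∞`; note `1 - q' = 1 - (1 - q⁻¹)⁻¹`. -/
def IsAq {n : ℕ} (w : (Fin n → ℝ) → ℝ) (q : ℝ) : Prop :=
  IsWeight w ∧ ∃ C : ℝ, ∀ Q : Cube n,
    avgOn Q.set w * avgOn Q.set (fun x => w x ^ (1 - (1 - q⁻¹)⁻¹)) ^ (q - 1) ≤ C

/-- `w ∈ A_q` for `1 ≤ q < ∞`. -/
def IsAqGen {n : ℕ} (w : (Fin n → ℝ) → ℝ) (q : ℝ) : Prop :=
  (q = 1 ∧ IsA1 w) ∨ (1 < q ∧ IsAq w q)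

/-- The class `A_∞`: the union of all the `A_q` classes. -/
def IsAinf {n : ℕ} (w : (Fin n → ℝ) → ℝ) : Prop :=
  IsA1 w ∨ ∃ q : ℝ, 1 < q ∧ IsAq w q

/-- `r_w = inf {r ∈ (1,∞) : w ∈ A_r}`. -/
def rIndex {n : ℕ} (w : (Fin n → ℝ) → ℝ) : ℝ :=
  sInf {r : ℝ | 1 < r ∧ IsAq w r}

/-- `⌊x⌋₊ = max (⌊x⌋, 0)` as an integer. -/
def floorPos (x : ℝ) : ℤ := max ⌊x⌋ 0

/-- The critical index `s_w = ⌊n (r_w/p - 1)⌋₊`. -/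
def critIndex {n : ℕ} (w : (Fin n → ℝ) → ℝ) (p : ℝ) : ℤ :=
  floorPos ((n : ℝ) * (rIndex w / p - 1))

/-! ### Weighted and variable Lebesgue norms -/

/-- The measure `w dx`. -/
def wMeasure {n : ℕ} (w : (Fin n → ℝ) → ℝ) : Measure (Fin n → ℝ) :=
  volume.withDensity fun x => ENNReal.ofReal (w x)

/-- `L^p(μ)` norm of an `ℝ≥0∞`-valued function. -/
def eLpNormE {n : ℕ} (p : ℝ) (μ : Measure (Fin n → ℝ)) (g : (Fin n → ℝ) → ℝ≥0∞) : ℝ≥0∞ :=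
  (∫⁻ x, g x ^ p ∂μ) ^ (1 / p)

/-- Weighted `L^p(w)` norm of an `ℝ≥0∞`-valued function. -/
def wLpNormE {n : ℕ} (p : ℝ) (w : (Fin n → ℝ) → ℝ) (g : (Fin n → ℝ) → ℝ≥0∞) : ℝ≥0∞ :=
  eLpNormE p (wMeasure w) g

/-- Weighted `L^p(w)` norm. -/
def wLpNorm {n : ℕ} (p : ℝ) (w f : (Fin n → ℝ) → ℝ) : ℝ≥0∞ :=
  wLpNormE p w fun x => ENNReal.ofReal |f x|

/-- Variable-exponent Lebesgue quasi-norm of an `ℝ≥0∞`-valued function. -/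
def vLpNormE {n : ℕ} (p : (Fin n → ℝ) → ℝ) (g : (Fin n → ℝ) → ℝ≥0∞) : ℝ≥0∞ :=
  sInf {lam : ℝ≥0∞ | 0 < lam ∧ ∫⁻ x, (g x / lam) ^ p x ≤ 1}

/-- Variable-exponent Lebesgue quasi-norm. -/
def vLpNorm {n : ℕ} (p : (Fin n → ℝ) → ℝ) (f : (Fin n → ℝ) → ℝ) : ℝ≥0∞ :=
  vLpNormE p fun x => ENNReal.ofReal |f x|

/-- Log-Hölder continuity of an exponent function. -/
def LogHolder {n : ℕ} (p : (Fin n → ℝ) → ℝ) : Prop :=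
  (∃ C₀ : ℝ, ∀ x y : Fin n → ℝ, 0 < ‖x - y‖ → ‖x - y‖ < 1 / 2 →
    |p x - p y| ≤ C₀ / (-Real.log ‖x - y‖)) ∧
  ∃ Ci pinf : ℝ, ∀ x : Fin n → ℝ, |p x - pinf| ≤ Ci / Real.log (Real.exp 1 + ‖x‖)

/-! ### Maximal functions and Hardy spaces -/

/-- Dilation `φ_t(x) = t^{-n} φ(x/t)`. -/
def dil {n : ℕ} (t : ℝ) (φ : (Fin n → ℝ) → ℝ) : (Fin n → ℝ) → ℝ :=
  fun x => (t ^ n)⁻¹ * φ (t⁻¹ • x)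

/-- Convolution `g * f`. -/
def conv {n : ℕ} (g f : (Fin n → ℝ) → ℝ) (x : Fin n → ℝ) : ℝ :=
  ∫ y, g (x - y) * f y

/-- The normalizing family `𝔉_{N₀}` of Schwartz functions. -/
def frakF (n N₀ : ℕ) : Set ((Fin n → ℝ) → ℝ) :=
  {φ | (∃ ψ : SchwartzMap (Fin n → ℝ) ℝ, ⇑ψ = φ) ∧
    ∫ x, (1 + ‖x‖) ^ N₀ * ∑ α ∈ multiIndices n N₀, pdMulti α φ x ^ 2 ≤ 1}

/-- The grand maximal function `𝓜_{N₀} f`. -/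
def grandMax (n N₀ : ℕ) (f : (Fin n → ℝ) → ℝ) (x : Fin n → ℝ) : ℝ≥0∞ :=
  ⨆ φ ∈ frakF n N₀, ⨆ (t : ℝ) (_ : 0 < t), ENNReal.ofReal |conv (dil t φ) f x|

/-- Weighted Hardy space quasi-norm `‖f‖_{H^p(w)} = ‖𝓜_{N₀} f‖_{L^p(w)}`. -/
def HpNorm (n N₀ : ℕ) (p : ℝ) (w f : (Fin n → ℝ) → ℝ) : ℝ≥0∞ :=
  wLpNormE p w (grandMax n N₀ f)

/-- Variable Hardy space quasi-norm. -/
def vHpNorm (n N₀ : ℕ) (q : (Fin n → ℝ) → ℝ) (f : (Fin n → ℝ) → ℝ) : ℝ≥0∞ :=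
  vLpNormE q (grandMax n N₀ f)

/-- A fixed smooth bump supported in the unit ball. -/
def IsAdmissiblePhi {n : ℕ} (φ : (Fin n → ℝ) → ℝ) : Prop :=
  ContDiff ℝ (⊤ : ℕ∞) φ ∧ HasCompactSupport φ ∧ tsupport φ ⊆ Metric.ball 0 1

/-- Nontangential maximal operator `M_φ g`. -/
def nontanMax {n : ℕ} (φ g : (Fin n → ℝ) → ℝ) (x : Fin n → ℝ) : ℝ≥0∞ :=
  ⨆ (t : ℝ) (_ : 0 < t) (y : Fin n → ℝ) (_ : ‖y - x‖ < t),
    ENNReal.ofReal |conv (dil t φ) g y|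

/-- The Hardy–Littlewood maximal operator (over cubes). -/
def MHL {n : ℕ} (f : (Fin n → ℝ) → ℝ) (x : Fin n → ℝ) : ℝ≥0∞ :=
  ⨆ (Q : Cube n) (_ : x ∈ Q.set),
    (∫⁻ y in Q.set, ENNReal.ofReal |f y|) / volume Q.set

/-! ### Atoms and the class `O_N` -/

/-- An `(N,∞)` atom supported in the cube `Q`. -/
def IsAtom {n : ℕ} (N : ℕ) (a : (Fin n → ℝ) → ℝ) (Q : Cube n) : Prop :=
  Measurable a ∧ (∀ x ∉ Q.set, a x = 0) ∧ (∀ᵐ x ∂volume, |a x| ≤ 1) ∧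
    ∀ β : Fin n → ℕ, (∑ i, β i) ≤ N → ∫ x, (∏ i, x i ^ β i) * a x = 0

/-- The class `O_N` of smooth compactly supported functions with vanishing
moments up to order `N`. -/
def ON (n N : ℕ) : Set ((Fin n → ℝ) → ℝ) :=
  {f | ContDiff ℝ (⊤ : ℕ∞) f ∧ HasCompactSupport f ∧
    ∀ α : Fin n → ℕ, (∑ i, α i) ≤ N → ∫ x, (∏ i, x i ^ α i) * f x = 0}

/-! ### Calderón–Zygmund kernels and operators -/

/-- Flatten an `(m+1)`-tuple of points of `ℝⁿ` to a point of `ℝ^{(m+1)n}`. -/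
def flat {n m : ℕ} (y : Fin (m + 1) → Fin n → ℝ) : Fin (m + 1) × Fin n → ℝ :=
  fun q => y q.1 q.2

/-- The kernel regularity condition of order `N`. -/
def KernelReg (n m N : ℕ) (K : (Fin (m + 1) × Fin n → ℝ) → ℝ) : Prop :=
  ∀ α : Fin (m + 1) × Fin n → ℕ, (∑ q, α q) ≤ N →
    ∃ A : ℝ, ∀ y : Fin (m + 1) → Fin n → ℝ, (¬ ∀ k l, y k = y l) →
      |pdMulti α K (flat y)| ≤
        A * (∑ k, ∑ l, ‖y k - y l‖) ^ (-((m * n + ∑ q, α q : ℕ) : ℝ))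

/-- `T` is an `m`-linear Calderón–Zygmund operator associated to the kernel `K`. -/
structure IsMCZO (n m : ℕ) (K : (Fin (m + 1) × Fin n → ℝ) → ℝ)
    (T : (Fin m → (Fin n → ℝ) → ℝ) → (Fin n → ℝ) → ℝ) : Prop where
  map_smul : ∀ (f : Fin m → (Fin n → ℝ) → ℝ) (k : Fin m) (c : ℝ) (g : (Fin n → ℝ) → ℝ),
    T (Function.update f k (c • g)) = c • T (Function.update f k g)
  map_add : ∀ (f : Fin m → (Fin n → ℝ) → ℝ) (k : Fin m) (g₁ g₂ : (Fin n → ℝ) → ℝ),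
    T (Function.update f k (g₁ + g₂)) =
      T (Function.update f k g₁) + T (Function.update f k g₂)
  bounded : ∃ q : Fin m → ℝ, (∀ k, 1 < q k) ∧ ∃ C : ℝ≥0,
    ∀ f : Fin m → (Fin n → ℝ) → ℝ,
      eLpNorm (T f) (ENNReal.ofReal ((∑ k, (q k)⁻¹)⁻¹)) volume ≤
        C * ∏ k, eLpNorm (f k) (ENNReal.ofReal (q k)) volume
  repr : ∀ f : Fin m → (Fin n → ℝ) → ℝ,
    (∀ k, Measurable (f k) ∧ HasCompactSupport (f k) ∧ ∃ B : ℝ, ∀ x, |f k x| ≤ B) →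
    ∀ x, x ∉ ⋂ k, tsupport (f k) →
      T f x = ∫ y : Fin m → Fin n → ℝ, K (flat (Fin.cons x y)) * ∏ k, f k (y k)

/-- `1/p = 1/p₁ + ⋯ + 1/p_m`. -/
def pbar {m : ℕ} (p : Fin m → ℝ) : ℝ := (∑ k, (p k)⁻¹)⁻¹

/-- `w̄ = ∏ w_k^{p/p_k}`. -/
def wbar {n m : ℕ} (p : Fin m → ℝ) (w : Fin m → (Fin n → ℝ) → ℝ) :
    (Fin n → ℝ) → ℝ :=
  fun x => ∏ k, w k x ^ (pbar p / p k)

theorem Cube.set_eq_closedBall {n : ℕ} (Q : Cube n) :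
    Q.set = Metric.closedBall Q.c (Q.h / 2) := by
  ext x
  simp [Cube.set, Metric.mem_closedBall, dist_pi_le_iff (half_pos Q.h_pos).le, Real.dist_eq]

theorem Cube.measurableSet_set {n : ℕ} (Q : Cube n) : MeasurableSet Q.set := by
  rw [Q.set_eq_closedBall]
  exact Metric.isClosed_closedBall.measurableSet

theorem Cube.measure_set_ne_top {n : ℕ} (μ : Measure (Fin n → ℝ)) [IsLocallyFiniteMeasure μ]
    (Q : Cube n) : μ Q.set ≠ ∞ := by
  rw [Q.set_eq_closedBall]
  exact (isCompact_closedBall _ _).measure_ne_top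

theorem Cube.measure_closedBall_five_le {n : ℕ} {μ : Measure (Fin n → ℝ)} {D : ℝ≥0}
    (hD : ∀ Q : Cube n, μ (Cube.scaleSet 2 Q) ≤ D * μ Q.set) (Q : Cube n) :
    μ (Metric.closedBall Q.c (5 * (Q.h / 2))) ≤ (D : ℝ≥0∞) ^ 3 * μ Q.set := by
  have step (Q : Cube n) : μ (Q.scale 2 two_pos).set ≤ D * μ Q.set := hD Q
  have hsub : Metric.closedBall Q.c (5 * (Q.h / 2)) ⊆
      (((Q.scale 2 two_pos).scale 2 two_pos).scale 2 two_pos).set := by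
    rw [Cube.set_eq_closedBall]
    apply Metric.closedBall_subset_closedBall
    simp only [Cube.scale]
    linarith [Q.h_pos]
  calc μ (Metric.closedBall Q.c (5 * (Q.h / 2)))
      ≤ D * (D * (D * μ Q.set)) :=
        (measure_mono hsub).trans <| (step _).trans <| by
          gcongr
          exact (step _).trans (by gcongr; exact step _)
    _ = (D : ℝ≥0∞) ^ 3 * μ Q.set := by ring

/-- The average of `g` over the cube `Q` with respect to `μ`. -/
def cubeAvg {n : ℕ} (μ : Measure (Fin n → ℝ)) (Q : Cube n) (g : (Fin n → ℝ) → ℝ≥0∞) : ℝ≥0∞ :=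
  (∫⁻ y in Q.set, g y ∂μ) / μ Q.set

/-- The maximal function of `g` over a finite family of cubes. -/
def cubeMax {n L : ℕ} (μ : Measure (Fin n → ℝ)) (Q : Fin L → Cube n) (g : (Fin n → ℝ) → ℝ≥0∞)
    (x : Fin n → ℝ) : ℝ≥0∞ :=
  Finset.univ.sup fun j => (Q j).set.indicator (fun _ => cubeAvg μ (Q j) g) x

theorem measurable_cubeMax {n L : ℕ} (μ : Measure (Fin n → ℝ)) (Q : Fin L → Cube n)
    (g : (Fin n → ℝ) → ℝ≥0∞) : Measurable (cubeMax μ Q g) := by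
  unfold cubeMax
  simp only [Finset.sup_eq_iSup]
  exact .iSup fun j => .iSup fun _ => measurable_const.indicator (Q j).measurableSet_set

theorem cubeAvg_le_cubeMax {n L : ℕ} (μ : Measure (Fin n → ℝ)) (Q : Fin L → Cube n)
    (g : (Fin n → ℝ) → ℝ≥0∞) (j : Fin L) {x : Fin n → ℝ} (hx : x ∈ (Q j).set) :
    cubeAvg μ (Q j) g ≤ cubeMax μ Q g x := by
  have := Finset.le_sup (f := fun j => (Q j).set.indicator (fun _ => cubeAvg μ (Q j) g) x)
    (Finset.mem_univ j)
  rwa [Set.indicator_of_mem hx] at this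

theorem exists_lt_cubeAvg_of_lt_cubeMax {n L : ℕ} {μ : Measure (Fin n → ℝ)} {Q : Fin L → Cube n}
    {g : (Fin n → ℝ) → ℝ≥0∞} {t : ℝ≥0∞} {x : Fin n → ℝ} (h : t < cubeMax μ Q g x) :
    ∃ j, t < cubeAvg μ (Q j) g ∧ x ∈ (Q j).set := by
  obtain ⟨j, -, hj⟩ := Finset.lt_sup_iff.1 h
  by_cases hx : x ∈ (Q j).set
  · exact ⟨j, by simpa [hx] using hj, hx⟩
  · simp [hx] at hj

theorem cubeAvg_ne_top {n : ℕ} {μ : Measure (Fin n → ℝ)} {Q : Cube n}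
    {g : (Fin n → ℝ) → ℝ≥0∞} (h : ∫⁻ y in Q.set, g y ∂μ ≠ ∞) : cubeAvg μ Q g ≠ ∞ := by
  by_cases h0 : μ Q.set = 0
  · simp [cubeAvg, setLIntegral_measure_zero _ _ h0]
  · exact ENNReal.div_ne_top h h0

theorem cubeMax_ne_top {n L : ℕ} {μ : Measure (Fin n → ℝ)} {Q : Fin L → Cube n}
    {g : (Fin n → ℝ) → ℝ≥0∞} (h : ∀ j, ∫⁻ y in (Q j).set, g y ∂μ ≠ ∞) (x : Fin n → ℝ) :
    cubeMax μ Q g x ≠ ∞ := by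
  refine ((Finset.sup_lt_iff ENNReal.zero_lt_top).2 fun j _ => ?_).ne
  by_cases hx : x ∈ (Q j).set
  · simpa [hx] using (cubeAvg_ne_top (h j)).lt_top
  · simp [hx]

/-- Vitali covering estimate for finitely many cubes on which the mean of `g` is at least `t`. -/
theorem mul_measure_biUnion_cube_le {n L : ℕ} {μ : Measure (Fin n → ℝ)} {D : ℝ≥0}
    (hD : ∀ Q : Cube n, μ (Cube.scaleSet 2 Q) ≤ D * μ Q.set) (Q : Fin L → Cube n)
    (g : (Fin n → ℝ) → ℝ≥0∞) (t : ℝ≥0∞) (S : Set (Fin L))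
    (hS : ∀ j ∈ S, t * μ (Q j).set ≤ ∫⁻ y in (Q j).set, g y ∂μ) :
    t * μ (⋃ j ∈ S, (Q j).set) ≤ (D : ℝ≥0∞) ^ 3 * ∫⁻ y, g y ∂μ := by
  classical
  obtain ⟨R, hR⟩ := (Set.finite_range fun j => (Q j).h / 2).bddAbove
  obtain ⟨u, huS, hdisj, hcov⟩ := Vitali.exists_disjoint_subfamily_covering_enlargement_closedBall
    S (fun j => (Q j).c) (fun j => (Q j).h / 2) R (fun j _ => hR ⟨j, rfl⟩) 5 (by norm_num)
  simp only [← Cube.set_eq_closedBall] at hdisj hcov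
  have hsub : (⋃ j ∈ S, (Q j).set) ⊆
      ⋃ b ∈ u.toFinset, Metric.closedBall (Q b).c (5 * ((Q b).h / 2)) := by
    refine Set.iUnion₂_subset fun j hj => ?_
    obtain ⟨b, hb, hjb⟩ := hcov j hj
    exact hjb.trans (Set.subset_biUnion_of_mem
      (u := fun b => Metric.closedBall (Q b).c (5 * ((Q b).h / 2))) (by simpa using hb))
  calc t * μ (⋃ j ∈ S, (Q j).set)
      ≤ t * ∑ b ∈ u.toFinset, (D : ℝ≥0∞) ^ 3 * μ (Q b).set := by
        gcongr
        refine (measure_mono hsub).trans ((measure_biUnion_finset_le _ _).trans ?_)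
        exact Finset.sum_le_sum fun b _ => Cube.measure_closedBall_five_le hD (Q b)
    _ = (D : ℝ≥0∞) ^ 3 * ∑ b ∈ u.toFinset, t * μ (Q b).set := by
        rw [← Finset.mul_sum, ← Finset.mul_sum, mul_left_comm]
    _ ≤ (D : ℝ≥0∞) ^ 3 * ∑ b ∈ u.toFinset, ∫⁻ y in (Q b).set, g y ∂μ := by
        gcongr with b hb
        exact hS b (huS (by simpa using hb))
    _ = (D : ℝ≥0∞) ^ 3 * ∫⁻ y in ⋃ b ∈ u.toFinset, (Q b).set, g y ∂μ := by
        rw [lintegral_biUnion_finset (by simpa using hdisj)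
          fun b _ => (Q b).measurableSet_set]
    _ ≤ (D : ℝ≥0∞) ^ 3 * ∫⁻ y, g y ∂μ := by
        gcongr
        exact Measure.restrict_le_self

/-- Truncated weak type estimate for the maximal function over finitely many cubes. -/
theorem measure_lt_cubeMax_mul_le {n L : ℕ} {μ : Measure (Fin n → ℝ)} [IsLocallyFiniteMeasure μ]
    {D : ℝ≥0} (hD : ∀ Q : Cube n, μ (Cube.scaleSet 2 Q) ≤ D * μ Q.set) (Q : Fin L → Cube n)
    {G : (Fin n → ℝ) → ℝ} (hG : AEMeasurable G μ) {t : ℝ} (ht : 0 < t) :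
    μ {x | ENNReal.ofReal t < cubeMax μ Q (fun y => ENNReal.ofReal (G y)) x} * ENNReal.ofReal t ≤
      2 * (D : ℝ≥0∞) ^ 3 *
        μ.withDensity (fun y => ENNReal.ofReal (G y)) {x | t < 2 * G x} := by
  set g : (Fin n → ℝ) → ℝ≥0∞ := fun y => ENNReal.ofReal (G y)
  set E : Set (Fin n → ℝ) := {x | t < 2 * G x}
  have hE : NullMeasurableSet E μ := nullMeasurableSet_lt aemeasurable_const (hG.const_mul 2)
  set S : Set (Fin L) := {j | ENNReal.ofReal t < cubeAvg μ (Q j) g}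
  have htt : ENNReal.ofReal t = ENNReal.ofReal (t / 2) + ENNReal.ofReal (t / 2) := by
    rw [← ENNReal.ofReal_add (by positivity) (by positivity), add_halves]
  have hS : ∀ j ∈ S, ENNReal.ofReal (t / 2) * μ (Q j).set ≤
      ∫⁻ y in (Q j).set, E.indicator g y ∂μ := by
    intro j hj
    have h1 : ENNReal.ofReal t * μ (Q j).set ≤ ∫⁻ y in (Q j).set, g y ∂μ :=
      ENNReal.mul_le_of_le_div (le_of_lt hj)
    have h2 : ∫⁻ y in (Q j).set, g y ∂μ ≤
        ENNReal.ofReal (t / 2) * μ (Q j).set + ∫⁻ y in (Q j).set, E.indicator g y ∂μ := by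
      rw [← setLIntegral_const, ← lintegral_add_left measurable_const]
      refine lintegral_mono fun y => ?_
      by_cases hy : y ∈ E
      · simp [hy]
      · have : G y ≤ t / 2 := by
          have : ¬ t < 2 * G y := hy
          linarith
        simpa [hy, g] using ENNReal.ofReal_le_ofReal this
    have h3 := h1.trans h2
    rw [htt, add_mul] at h3
    exact (ENNReal.add_le_add_iff_left
      (ENNReal.mul_ne_top ENNReal.ofReal_ne_top ((Q j).measure_set_ne_top μ))).1 h3
  have hsub : {x | ENNReal.ofReal t < cubeMax μ Q g x} ⊆ ⋃ j ∈ S, (Q j).set := by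
    intro x hx
    obtain ⟨j, hj, hxj⟩ := exists_lt_cubeAvg_of_lt_cubeMax hx
    exact Set.mem_biUnion (show j ∈ S from hj) hxj
  calc μ {x | ENNReal.ofReal t < cubeMax μ Q g x} * ENNReal.ofReal t
      ≤ μ (⋃ j ∈ S, (Q j).set) * ENNReal.ofReal t := by gcongr
    _ = 2 * (ENNReal.ofReal (t / 2) * μ (⋃ j ∈ S, (Q j).set)) := by rw [htt]; ring
    _ ≤ 2 * ((D : ℝ≥0∞) ^ 3 * ∫⁻ y, E.indicator g y ∂μ) := by
        gcongr 2 * ?_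
        exact mul_measure_biUnion_cube_le hD Q _ _ S hS
    _ = 2 * (D : ℝ≥0∞) ^ 3 * μ.withDensity g E := by
        rw [lintegral_indicator₀ hE, withDensity_apply', mul_assoc]

/-- Strong type estimate for the maximal function over finitely many cubes. -/
theorem exists_lintegral_cubeMax_rpow_le {n : ℕ} {μ : Measure (Fin n → ℝ)}
    [IsLocallyFiniteMeasure μ] {D : ℝ≥0}
    (hD : ∀ Q : Cube n, μ (Cube.scaleSet 2 Q) ≤ D * μ Q.set) {r : ℝ} (hr : 1 < r) :
    ∃ K : ℝ≥0∞, K ≠ ∞ ∧ ∀ (L : ℕ) (Q : Fin L → Cube n) (G : (Fin n → ℝ) → ℝ),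
      AEMeasurable G μ → (∀ x, 0 ≤ G x) →
      (∀ j, ∫⁻ y in (Q j).set, ENNReal.ofReal (G y) ∂μ ≠ ∞) →
      ∫⁻ x, cubeMax μ Q (fun y => ENNReal.ofReal (G y)) x ^ r ∂μ ≤
        K * ∫⁻ x, ENNReal.ofReal (G x ^ r) ∂μ := by
  have hr1 : 0 < r - 1 := by linarith
  refine ⟨ENNReal.ofReal r * (2 * (D : ℝ≥0∞) ^ 3 * ((ENNReal.ofReal (r - 1))⁻¹ *
    ENNReal.ofReal (2 ^ (r - 1)))), ?_, fun L Q G hG hG0 hfin => ?_⟩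
  · have : (ENNReal.ofReal (r - 1))⁻¹ ≠ ∞ := by simpa using hr
    finiteness
  set g : (Fin n → ℝ) → ℝ≥0∞ := fun y => ENNReal.ofReal (G y)
  set ν := μ.withDensity g
  have hgm : AEMeasurable g μ := hG.ennreal_ofReal
  have hνμ : ν ≪ μ := withDensity_absolutelyContinuous _ _
  have hMfin := cubeMax_ne_top hfin
  have hν : ∫⁻ x, ENNReal.ofReal ((2 * G x) ^ (r - 1)) ∂ν =
      ENNReal.ofReal (2 ^ (r - 1)) * ∫⁻ x, ENNReal.ofReal (G x ^ r) ∂μ := by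
    rw [lintegral_withDensity_eq_lintegral_mul₀ hgm (by fun_prop),
      ← lintegral_const_mul' _ _ ENNReal.ofReal_ne_top]
    refine lintegral_congr fun x => ?_
    have h : G x * (2 * G x) ^ (r - 1) = 2 ^ (r - 1) * G x ^ r := by
      rw [Real.mul_rpow two_pos.le (hG0 x), mul_left_comm, ← Real.rpow_one_add' (hG0 x) (by linarith)]
      ring_nf
    simp only [Pi.mul_apply, g]
    rw [← ENNReal.ofReal_mul (hG0 x), h, ENNReal.ofReal_mul (by positivity)]
  have hlayer := lintegral_rpow_eq_lintegral_meas_lt_mul ν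
    (f := fun x => 2 * G x) (.of_forall fun x => mul_nonneg two_pos.le (hG0 x))
    ((hG.mono_ac hνμ).const_mul 2) hr1
  calc ∫⁻ x, cubeMax μ Q g x ^ r ∂μ
      = ∫⁻ x, ENNReal.ofReal ((cubeMax μ Q g x).toReal ^ r) ∂μ := by
        refine lintegral_congr fun x => ?_
        rw [← ENNReal.ofReal_rpow_of_nonneg ENNReal.toReal_nonneg (by linarith),
          ENNReal.ofReal_toReal (hMfin x)]
    _ = ENNReal.ofReal r * ∫⁻ t in Ioi 0, μ {x | t < (cubeMax μ Q g x).toReal} *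
          ENNReal.ofReal (t ^ (r - 1)) :=
        lintegral_rpow_eq_lintegral_meas_lt_mul μ (.of_forall fun _ => ENNReal.toReal_nonneg)
          (measurable_cubeMax μ Q g).ennreal_toReal.aemeasurable (by linarith)
    _ ≤ ENNReal.ofReal r * ∫⁻ t in Ioi 0, 2 * (D : ℝ≥0∞) ^ 3 *
          (ν {x | t < 2 * G x} * ENNReal.ofReal (t ^ (r - 1 - 1))) := by
        gcongr 1
        refine setLIntegral_mono' measurableSet_Ioi fun t (ht : 0 < t) => ?_
        have hset : {x | t < (cubeMax μ Q g x).toReal} = {x | ENNReal.ofReal t < cubeMax μ Q g x} := by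
          ext x
          exact (ENNReal.ofReal_lt_iff_lt_toReal ht.le (hMfin x)).symm
        have hpow : ENNReal.ofReal (t ^ (r - 1)) =
            ENNReal.ofReal t * ENNReal.ofReal (t ^ (r - 1 - 1)) := by
          rw [← ENNReal.ofReal_mul ht.le, Real.rpow_sub_one ht.ne' (r - 1), mul_div_cancel₀ _ ht.ne']
        rw [hset, hpow, ← mul_assoc, ← mul_assoc]
        gcongr ?_ * _
        exact measure_lt_cubeMax_mul_le hD Q hG ht
    _ = ENNReal.ofReal r * (2 * (D : ℝ≥0∞) ^ 3 * ∫⁻ t in Ioi 0,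
          ν {x | t < 2 * G x} * ENNReal.ofReal (t ^ (r - 1 - 1))) := by
        rw [lintegral_const_mul' _ _ (by finiteness)]
    _ = ENNReal.ofReal r * (2 * (D : ℝ≥0∞) ^ 3 * ((ENNReal.ofReal (r - 1))⁻¹ *
          ∫⁻ x, ENNReal.ofReal ((2 * G x) ^ (r - 1)) ∂ν)) := by
        rw [hlayer, ← mul_assoc (ENNReal.ofReal (r - 1))⁻¹,
          ENNReal.inv_mul_cancel (by simpa using hr) ENNReal.ofReal_ne_top, one_mul]
    _ = _ := by rw [hν]; ring

/-- Hölder's inequality on a cube, in terms of averages. -/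
theorem setLIntegral_mul_le_cubeAvg {n : ℕ} {μ : Measure (Fin n → ℝ)} [IsLocallyFiniteMeasure μ]
    (Q : Cube n) {q q' : ℝ} (hq : q.HolderConjugate q') {f g : (Fin n → ℝ) → ℝ≥0∞}
    (hf : AEMeasurable f μ) (hg : AEMeasurable g μ) :
    ∫⁻ x in Q.set, f x * g x ∂μ ≤
      cubeAvg μ Q (fun x => f x ^ q) ^ (1 / q) * cubeAvg μ Q (fun x => g x ^ q') ^ (1 / q') *
        μ Q.set := by
  by_cases h0 : μ Q.set = 0
  · simp [setLIntegral_measure_zero _ _ h0]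
  have htop := Q.measure_set_ne_top μ
  refine (ENNReal.lintegral_mul_le_Lp_mul_Lq (μ.restrict Q.set) hq hf.restrict hg.restrict).trans_eq ?_
  have hsplit : ∀ s : ℝ, 0 < s → ∀ I : ℝ≥0∞,
      I ^ (1 / s) = (I / μ Q.set) ^ (1 / s) * μ Q.set ^ (1 / s) := fun s hs I => by
    rw [← ENNReal.mul_rpow_of_nonneg _ _ (by positivity), ENNReal.div_mul_cancel h0 htop]
  have hμ : μ Q.set ^ (1 / q) * μ Q.set ^ (1 / q') = μ Q.set := by
    rw [← ENNReal.rpow_add _ _ h0 htop, one_div, one_div, hq.inv_add_inv_eq_one, ENNReal.rpow_one]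
  rw [hsplit q hq.pos, hsplit q' hq.symm.pos, mul_mul_mul_comm, hμ]
  rfl

/-- Testing a sum of functions supported in cubes against `g`: the functions may be replaced by
their `L^q` averages at the price of replacing `g` by its maximal function of order `q'`. -/
theorem lintegral_sum_mul_le_cubeMax {n L : ℕ} {μ : Measure (Fin n → ℝ)} [IsLocallyFiniteMeasure μ]
    (Q : Fin L → Cube n) {q q' : ℝ} (hq : q.HolderConjugate q') {f : Fin L → (Fin n → ℝ) → ℝ≥0∞}
    {g : (Fin n → ℝ) → ℝ≥0∞} (hf : ∀ j, AEMeasurable (f j) μ) (hg : AEMeasurable g μ)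
    (hsupp : ∀ j, ∀ x ∉ (Q j).set, f j x = 0) :
    ∫⁻ x, (∑ j, f j x) * g x ∂μ ≤
      ∫⁻ x, (∑ j, cubeAvg μ (Q j) (fun y => f j y ^ q) ^ (1 / q) *
        (Q j).set.indicator (fun _ => 1) x) *
          cubeMax μ Q (fun y => g y ^ q') x ^ (1 / q') ∂μ := by
  have hM := measurable_cubeMax μ Q fun y => g y ^ q'
  have hmeas (j) : Measurable fun x => cubeAvg μ (Q j) (fun y => f j y ^ q) ^ (1 / q) *
      (Q j).set.indicator (fun _ => 1) x * cubeMax μ Q (fun y => g y ^ q') x ^ (1 / q') :=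
    ((measurable_const.indicator (Q j).measurableSet_set).const_mul _).mul (hM.pow_const _)
  simp only [Finset.sum_mul]
  rw [lintegral_finsetSum' _ fun j _ => by fun_prop,
    lintegral_finsetSum' _ fun j _ => (hmeas j).aemeasurable]
  refine Finset.sum_le_sum fun j _ => ?_
  have hind : ∫⁻ x, f j x * g x ∂μ = ∫⁻ x in (Q j).set, f j x * g x ∂μ := by
    rw [← lintegral_indicator (Q j).measurableSet_set]
    refine lintegral_congr fun x => ?_
    by_cases hx : x ∈ (Q j).set
    · simp [hx]
    · simp [hx, hsupp j x hx]
  rw [hind]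
  refine (setLIntegral_mul_le_cubeAvg (Q j) hq (hf j) hg).trans ?_
  rw [← lintegral_indicator_const (Q j).measurableSet_set]
  refine lintegral_mono fun x => ?_
  by_cases hx : x ∈ (Q j).set
  · simp only [hx, Set.indicator_of_mem, mul_one]
    gcongr
    · exact one_div_nonneg.2 hq.symm.nonneg
    · exact cubeAvg_le_cubeMax μ Q _ j hx
  · simp [hx]

theorem lintegral_sum_le_lintegral_sum_cubeAvg {n L : ℕ} {μ : Measure (Fin n → ℝ)} [IsLocallyFiniteMeasure μ]
    (Q : Fin L → Cube n) {q q' : ℝ} (hq : q.HolderConjugate q') {f : Fin L → (Fin n → ℝ) → ℝ≥0∞}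
    (hf : ∀ j, AEMeasurable (f j) μ) (hsupp : ∀ j, ∀ x ∉ (Q j).set, f j x = 0) :
    ∫⁻ x, ∑ j, f j x ∂μ ≤
      ∫⁻ x, ∑ j, cubeAvg μ (Q j) (fun y => f j y ^ q) ^ (1 / q) *
        (Q j).set.indicator (fun _ => 1) x ∂μ := by
  have h := lintegral_sum_mul_le_cubeMax (g := fun _ => 1) Q hq hf aemeasurable_const hsupp
  simp only [mul_one] at h
  refine h.trans (lintegral_mono fun x => mul_le_of_le_one_right' ?_)
  refine ENNReal.rpow_le_one (Finset.sup_le fun j _ => ?_) (one_div_nonneg.2 hq.symm.nonneg)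
  by_cases hx : x ∈ (Q j).set
  · simp [hx, cubeAvg, ENNReal.div_self_le_one]
  · simp [hx]

/-- A sum of functions supported in cubes with finite `L^q` averages has finite `L^p` norm for
`p < q`. -/
theorem lintegral_sum_rpow_ne_top {n L : ℕ} {μ : Measure (Fin n → ℝ)} [IsLocallyFiniteMeasure μ]
    (Q : Fin L → Cube n) {p q : ℝ} (hp : 1 ≤ p) (hpq : p < q) {f : Fin L → (Fin n → ℝ) → ℝ}
    (hf : ∀ j, AEMeasurable (f j) μ) (hf0 : ∀ j x, 0 ≤ f j x)
    (hsupp : ∀ j, ∀ x ∉ (Q j).set, f j x = 0)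
    (hfin : ∀ j, cubeAvg μ (Q j) (fun y => ENNReal.ofReal (f j y) ^ q) ≠ ∞) :
    ∫⁻ x, ENNReal.ofReal (∑ j, f j x) ^ p ∂μ ≠ ∞ := by
  have hmem (j) : MemLp (f j) (ENNReal.ofReal p) μ := by
    refine MemLp.mono_exponent_of_measure_support_ne_top (q := ENNReal.ofReal q) ?_ (hsupp j)
      ((Q j).measure_set_ne_top μ) (ENNReal.ofReal_le_ofReal hpq.le)
    have hq0 : 0 < q := by linarith
    refine ⟨(hf j).aestronglyMeasurable, ?_⟩
    rw [eLpNorm_lt_top_iff_lintegral_rpow_enorm_lt_top (by simpa using hq0) ENNReal.ofReal_ne_top,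
      ENNReal.toReal_ofReal hq0.le]
    have hind : ∫⁻ x, ‖f j x‖ₑ ^ q ∂μ = ∫⁻ x in (Q j).set, ENNReal.ofReal (f j x) ^ q ∂μ := by
      rw [← lintegral_indicator (Q j).measurableSet_set]
      refine lintegral_congr fun x => ?_
      rw [Real.enorm_eq_ofReal (hf0 j x)]
      by_cases hx : x ∈ (Q j).set
      · simp [hx]
      · simp [hx, hsupp j x hx, hq0]
    rw [hind]
    by_contra htop
    have htop' := not_lt_top_iff.1 htop
    exact hfin j (by simp [cubeAvg, htop', ENNReal.top_div, (Q j).measure_set_ne_top μ])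
  have hsum : MemLp (fun x => ∑ j, f j x) (ENNReal.ofReal p) μ :=
    memLp_finsetSum _ fun j _ => hmem j
  have h := lintegral_rpow_enorm_lt_top_of_eLpNorm_lt_top (by simp; linarith)
    ENNReal.ofReal_ne_top hsum.2
  rw [ENNReal.toReal_ofReal (by linarith)] at h
  simpa only [Real.enorm_eq_ofReal (Finset.sum_nonneg fun j _ => hf0 j _)] using h.ne

theorem eLpNormE_sum_cubeAvg_eq_top {n L : ℕ} {μ : Measure (Fin n → ℝ)} (Q : Fin L → Cube n)
    {p q : ℝ} (hp : 0 < p) (hq : 0 < q) {g : Fin L → (Fin n → ℝ) → ℝ≥0∞} {j : Fin L}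
    (hj : cubeAvg μ (Q j) (g j) = ∞) :
    eLpNormE p μ (fun x => ∑ j, cubeAvg μ (Q j) (g j) ^ (1 / q) *
      (Q j).set.indicator (fun _ => (1 : ℝ≥0∞)) x) = ∞ := by
  have h0 : μ (Q j).set ≠ 0 := fun h0 => by
    simp [cubeAvg, setLIntegral_measure_zero _ _ h0] at hj
  have hint : ∫⁻ x, (∑ j, cubeAvg μ (Q j) (g j) ^ (1 / q) *
      (Q j).set.indicator (fun _ => (1 : ℝ≥0∞)) x) ^ p ∂μ = ∞ := by
    rw [← top_le_iff]
    calc ∞ = ∫⁻ _ in (Q j).set, ∞ ∂μ := by rw [setLIntegral_const, ENNReal.top_mul h0]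
      _ ≤ ∫⁻ x in (Q j).set, (∑ j, cubeAvg μ (Q j) (g j) ^ (1 / q) *
          (Q j).set.indicator (fun _ => (1 : ℝ≥0∞)) x) ^ p ∂μ := by
        refine setLIntegral_mono' (Q j).measurableSet_set fun x hx => ?_
        have h := Finset.single_le_sum (f := fun j => cubeAvg μ (Q j) (g j) ^ (1 / q) *
          (Q j).set.indicator (fun _ => (1 : ℝ≥0∞)) x) (fun _ _ => zero_le)
          (Finset.mem_univ j)
        simp only [hj, hx, Set.indicator_of_mem, mul_one,
          ENNReal.top_rpow_of_pos (one_div_pos.2 hq), top_le_iff] at h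
        rw [h, ENNReal.top_rpow_of_pos hp]
      _ ≤ _ := setLIntegral_le_lintegral _ _
  rw [eLpNormE, hint, ENNReal.top_rpow_of_pos (one_div_pos.2 hp)]

/-- The averaging estimate for `1 < p < q` when all the `L^q` averages are finite. -/
theorem exists_eLpNormE_sum_le_cubeAvg {n : ℕ} {μ : Measure (Fin n → ℝ)}
    [IsLocallyFiniteMeasure μ] {D : ℝ≥0}
    (hD : ∀ Q : Cube n, μ (Cube.scaleSet 2 Q) ≤ D * μ Q.set) {p q : ℝ} (hp : 1 < p)
    (hpq : p < q) :
    ∃ K : ℝ≥0∞, K ≠ ∞ ∧ ∀ (L : ℕ) (Q : Fin L → Cube n) (f : Fin L → (Fin n → ℝ) → ℝ),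
      (∀ j, AEMeasurable (f j) μ) → (∀ j x, 0 ≤ f j x) →
      (∀ j, ∀ x ∉ (Q j).set, f j x = 0) →
      (∀ j, cubeAvg μ (Q j) (fun y => ENNReal.ofReal (f j y) ^ q) ≠ ∞) →
      eLpNormE p μ (fun x => ∑ j, ENNReal.ofReal (f j x)) ≤
        K * eLpNormE p μ (fun x => ∑ j,
          cubeAvg μ (Q j) (fun y => ENNReal.ofReal (f j y) ^ q) ^ (1 / q) *
            (Q j).set.indicator (fun _ => (1 : ℝ≥0∞)) x) := by
  have hp0 : 0 < p := by linarith
  have hp1 : 0 < p - 1 := by linarith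
  have hq1 : 0 < q - 1 := by linarith
  have hqq := Real.HolderConjugate.conjExponent (hp.trans hpq)
  have hpp := Real.HolderConjugate.conjExponent hp
  set q' := q.conjExponent with hq'
  set p' := p.conjExponent with hp'
  have hq'0 : 0 < q' := hqq.symm.pos
  have hp'0 : 0 < p' := hpp.symm.pos
  have hpp' : (p - 1) * p' = p := by
    rw [hp', Real.conjExponent, mul_div_cancel₀ _ hp1.ne']
  have hr : 1 < p' / q' := by
    rw [one_lt_div hq'0, hq', hp', Real.conjExponent, Real.conjExponent,
      div_lt_div_iff₀ hq1 hp1]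
    linarith
  have hqr : q' * (p' / q') = p' := mul_div_cancel₀ _ hq'0.ne'
  obtain ⟨K, hK, hmax⟩ := exists_lintegral_cubeMax_rpow_le hD hr
  refine ⟨K ^ (1 / p'), ENNReal.rpow_ne_top_of_nonneg (by positivity) hK,
    fun L Q f hf hf0 hsupp hfin => ?_⟩
  set F : (Fin n → ℝ) → ℝ := fun x => ∑ j, f j x
  have hF0 (x) : 0 ≤ F x := Finset.sum_nonneg fun j _ => hf0 j x
  have hF : AEMeasurable F μ := Finset.aemeasurable_fun_sum _ fun j _ => hf j
  have hFsum (x) : ∑ j, ENNReal.ofReal (f j x) = ENNReal.ofReal (F x) :=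
    (ENNReal.ofReal_sum_of_nonneg fun j _ => hf0 j x).symm
  set S : (Fin n → ℝ) → ℝ≥0∞ := fun x => ∑ j,
    cubeAvg μ (Q j) (fun y => ENNReal.ofReal (f j y) ^ q) ^ (1 / q) *
      (Q j).set.indicator (fun _ => (1 : ℝ≥0∞)) x
  have hS : AEMeasurable S μ := Measurable.aemeasurable <| Finset.measurable_sum _ fun j _ =>
    (measurable_const.indicator (Q j).measurableSet_set).const_mul _
  set I := ∫⁻ x, ENNReal.ofReal (F x) ^ p ∂μ
  have hI : I ≠ ∞ := lintegral_sum_rpow_ne_top Q hp.le hpq hf hf0 hsupp hfin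
  set G : (Fin n → ℝ) → ℝ := fun x => (F x ^ (p - 1)) ^ q'
  have hG0 (x) : 0 ≤ G x := by have := hF0 x; positivity
  have hG : AEMeasurable G μ := (hF.pow_const _).pow_const _
  have hGr (x) : ENNReal.ofReal (G x ^ (p' / q')) = ENNReal.ofReal (F x) ^ p := by
    have h := hF0 x
    rw [ENNReal.ofReal_rpow_of_nonneg h hp0.le, ← Real.rpow_mul (by positivity), hqr,
      ← Real.rpow_mul h, hpp']
  have hGfin (j) : ∫⁻ y in (Q j).set, ENNReal.ofReal (G y) ∂μ ≠ ∞ := by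
    have hle : ∫⁻ y in (Q j).set, ENNReal.ofReal (G y) ∂μ ≤ μ (Q j).set + I := by
      calc ∫⁻ y in (Q j).set, ENNReal.ofReal (G y) ∂μ
          ≤ ∫⁻ y in (Q j).set, (1 + ENNReal.ofReal (F y) ^ p) ∂μ := by
            refine lintegral_mono fun y => ?_
            rw [← hGr, ← ENNReal.ofReal_one, ← ENNReal.ofReal_add zero_le_one
              (Real.rpow_nonneg (hG0 y) _)]
            refine ENNReal.ofReal_le_ofReal ?_
            rcases le_total (G y) 1 with h | h
            · linarith [Real.rpow_nonneg (hG0 y) (p' / q')]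
            · linarith [Real.self_le_rpow_of_one_le h hr.le]
        _ = μ (Q j).set + ∫⁻ y in (Q j).set, ENNReal.ofReal (F y) ^ p ∂μ := by
            rw [lintegral_add_left measurable_const, setLIntegral_one]
        _ ≤ μ (Q j).set + I := by
            gcongr
            exact setLIntegral_le_lintegral _ _
    exact ne_top_of_le_ne_top (ENNReal.add_ne_top.2 ⟨(Q j).measure_set_ne_top μ, hI⟩) hle
  have hgG : (fun y => ENNReal.ofReal (F y ^ (p - 1)) ^ q') = fun y => ENNReal.ofReal (G y) := by
    ext y
    exact ENNReal.ofReal_rpow_of_nonneg (Real.rpow_nonneg (hF0 y) _) hq'0.le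
  have hM := hmax L Q G hG hG0 hGfin
  simp only [hGr] at hM
  have hmain : I ≤ eLpNormE p μ S * (K * I) ^ (1 / p') := by
    calc I = ∫⁻ x, (∑ j, ENNReal.ofReal (f j x)) * ENNReal.ofReal (F x ^ (p - 1)) ∂μ := by
          refine lintegral_congr fun x => ?_
          rw [hFsum, ← ENNReal.ofReal_mul (hF0 x), ← Real.rpow_one_add' (hF0 x) (by linarith),
            ENNReal.ofReal_rpow_of_nonneg (hF0 x) hp0.le, add_sub_cancel]
      _ ≤ ∫⁻ x, S x * cubeMax μ Q (fun y => ENNReal.ofReal (G y)) x ^ (1 / q') ∂μ := by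
          rw [← hgG]
          exact lintegral_sum_mul_le_cubeMax Q hqq (fun j => (hf j).ennreal_ofReal)
            (hF.pow_const _).ennreal_ofReal fun j x hx => by simp [hsupp j x hx]
      _ ≤ eLpNormE p μ S *
          (∫⁻ x, (cubeMax μ Q (fun y => ENNReal.ofReal (G y)) x ^ (1 / q')) ^ p' ∂μ) ^ (1 / p') :=
          ENNReal.lintegral_mul_le_Lp_mul_Lq μ hpp hS
            ((measurable_cubeMax μ Q _).pow_const _).aemeasurable
      _ ≤ eLpNormE p μ S * (K * I) ^ (1 / p') := by
          simp only [← ENNReal.rpow_mul, one_div_mul_eq_div]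
          gcongr
  simp only [hFsum]
  change I ^ (1 / p) ≤ _
  by_cases hI0 : I = 0
  · simp [hI0, hp0]
  have hIp : I ^ (1 / p') ≠ 0 := by simp [hI0, hI]
  have hIp' : I ^ (1 / p') ≠ ∞ := ENNReal.rpow_ne_top_of_nonneg (by positivity) hI
  refine (ENNReal.mul_le_mul_iff_left hIp hIp').1 ?_
  calc I ^ (1 / p) * I ^ (1 / p') = I := by
        rw [← ENNReal.rpow_add _ _ hI0 hI, one_div, one_div, hpp.inv_add_inv_eq_one,
          ENNReal.rpow_one]
    _ ≤ eLpNormE p μ S * (K * I) ^ (1 / p') := hmain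
    _ = K ^ (1 / p') * eLpNormE p μ S * I ^ (1 / p') := by
        rw [ENNReal.mul_rpow_of_nonneg _ _ (by positivity)]
        ring

/-- Lemma 3.3: averaging lemma for doubling measures, `1 ≤ p < q`. -/
theorem statement8 (n : ℕ) (hn : 1 ≤ n) (μ : Measure (Fin n → ℝ))
    [IsLocallyFiniteMeasure μ]
    (hμ : ∃ C : ℝ≥0, ∀ Q : Cube n, μ (Cube.scaleSet 2 Q) ≤ C * μ Q.set)
    (p q : ℝ) (hp : 1 ≤ p) (hpq : p < q) :
    ∃ C : ℝ≥0, ∀ (L : ℕ) (Q : Fin L → Cube n) (f : Fin L → (Fin n → ℝ) → ℝ),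
      (∀ j, Integrable (f j) μ ∧ (∀ x, 0 ≤ f j x) ∧ ∀ x ∉ (Q j).set, f j x = 0) →
      eLpNormE p μ (fun x => ∑ j, ENNReal.ofReal (f j x)) ≤
        C * eLpNormE p μ (fun x => ∑ j,
          (((∫⁻ y in (Q j).set, ENNReal.ofReal (f j y) ^ q ∂μ) / μ (Q j).set) ^ (1 / q)) *
            (Q j).set.indicator (fun _ => (1 : ℝ≥0∞)) x) := by
  obtain ⟨D, hD⟩ := hμ
  have hq1 : 1 < q := hp.trans_lt hpq
  have hqq := Real.HolderConjugate.conjExponent hq1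
  set q' := q.conjExponent
  rcases hp.eq_or_lt with rfl | hp1
  · refine ⟨1, fun L Q f hf => ?_⟩
    simpa [eLpNormE, cubeAvg] using lintegral_sum_le_lintegral_sum_cubeAvg Q hqq
      (fun j => (hf j).1.1.aemeasurable.ennreal_ofReal)
      (fun j x hx => by simp [(hf j).2.2 x hx])
  obtain ⟨K, hK, hmax⟩ := exists_eLpNormE_sum_le_cubeAvg hD hp1 hpq
  refine ⟨K.toNNReal + 1, fun L Q f hf => ?_⟩
  have hp0 : 0 < p := by linarith
  have hK' : ((K.toNNReal + 1 : ℝ≥0) : ℝ≥0∞) = K + 1 := by simp [hK]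
  rw [hK']
  by_cases hfin : ∀ j, cubeAvg μ (Q j) (fun y => ENNReal.ofReal (f j y) ^ q) ≠ ∞
  · exact (hmax L Q f (fun j => (hf j).1.1.aemeasurable) (fun j => (hf j).2.1)
      (fun j => (hf j).2.2) hfin).trans (mul_le_mul_left le_self_add _)
  · push Not at hfin
    obtain ⟨j, hj⟩ := hfin
    suffices h : eLpNormE p μ (fun x => ∑ j,
        cubeAvg μ (Q j) (fun y => ENNReal.ofReal (f j y) ^ q) ^ (1 / q) *
          (Q j).set.indicator (fun _ => (1 : ℝ≥0∞)) x) = ∞ by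
      change _ ≤ _ * eLpNormE p μ (fun x => ∑ j,
        cubeAvg μ (Q j) (fun y => ENNReal.ofReal (f j y) ^ q) ^ (1 / q) *
          (Q j).set.indicator (fun _ => (1 : ℝ≥0∞)) x)
      rw [h, ENNReal.mul_top (by simp)]
      exact le_top
    exact eLpNormE_sum_cubeAvg_eq_top Q hp0 (by linarith) hj

end Paper

end
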